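/- Let a, b be integers with 0 < b < a and let β be the unique real root greater than 1 of the polynomial P(X) = X^3 − aX^2 − bX + 1. If (a, b) ≠ (2, 1) then 2 ≤ L_⊗(β) ≤ 4, while if (a, b) = (2, 1) then 3 ≤ L_⊗(β) ≤ 5. -/

import Mathlib

open Polynomial

/-- The β-transformation `T_β(x) = βx - ⌊βx⌋`. -/
noncomputable def betaT (β : ℝ) : ℝ → ℝ := fun x => β * x - ⌊β * x⌋

/-- `fin(β)`: reals `x` such that `|x|/β^N ∈ [0,1)` and the greedy expansion of
`|x|/β^N` is finite, for some `N, n ∈ ℕ`. -/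
def finBeta (β : ℝ) : Set ℝ :=
  {x | ∃ N n : ℕ, |x| / β ^ N ∈ Set.Ico (0 : ℝ) 1 ∧ (betaT β)^[n] (|x| / β ^ N) = 0}

/-- `ℤ_β`: the set of β-integers. -/
def betaInt (β : ℝ) : Set ℝ :=
  {x | ∃ N : ℕ, |x| / β ^ N ∈ Set.Ico (0 : ℝ) 1 ∧ (betaT β)^[N] (|x| / β ^ N) = 0}

/-- `L_⊕(β)`: the least `L ∈ ℕ` such that `β^L·(x+y) ∈ ℤ_β` for all
`x, y ∈ ℤ_β` with `x + y ∈ fin(β)`. -/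
noncomputable def Lplus (β : ℝ) : ℕ :=
  sInf {L : ℕ | ∀ x ∈ betaInt β, ∀ y ∈ betaInt β,
    x + y ∈ finBeta β → β ^ L * (x + y) ∈ betaInt β}

/-- `L_⊗(β)`: the least `L ∈ ℕ` such that `β^L·(x·y) ∈ ℤ_β` for all
`x, y ∈ ℤ_β` with `x·y ∈ fin(β)`. -/
noncomputable def Lmul (β : ℝ) : ℕ :=
  sInf {L : ℕ | ∀ x ∈ betaInt β, ∀ y ∈ betaInt β,
    x * y ∈ finBeta β → β ^ L * (x * y) ∈ betaInt β}

/-- The value `Σ dᵢ β^{-i}` (`i ≥ 1`) of a digit string. -/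
noncomputable def digitVal (β : ℝ) : List ℤ → ℝ
  | [] => 0
  | d :: ds => (d + digitVal β ds) / β

/-- Digit strings with nonnegative digits all of whose suffixes have value less than one. -/
def Admissible (β : ℝ) : List ℤ → Prop
  | [] => True
  | d :: ds => 0 ≤ d ∧ (d : ℝ) + digitVal β ds < β ∧ Admissible β ds

theorem betaT_digit {β t : ℝ} (hβ : 1 < β) (d : ℤ) (h0 : 0 ≤ t) (h1 : t < 1) :
    betaT β ((d + t) / β) = t := by
  have hne : β ≠ 0 := by positivity
  have hfl : ⌊(d : ℝ) + t⌋ = d := by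
    rw [Int.floor_eq_iff]; constructor <;> linarith
  simp only [betaT, mul_div_cancel₀ _ hne]
  rw [hfl]; ring

theorem betaT_zero (β : ℝ) : betaT β 0 = 0 := by simp [betaT]

theorem betaT_nonneg (β t : ℝ) : 0 ≤ betaT β t :=
  Int.fract_nonneg (β * t)

theorem betaT_lt_one (β t : ℝ) : betaT β t < 1 :=
  Int.fract_lt_one (β * t)

theorem iterate_betaT_mem {β t : ℝ} (ht : t ∈ Set.Ico (0 : ℝ) 1) (n : ℕ) :
    (betaT β)^[n] t ∈ Set.Ico (0 : ℝ) 1 := by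
  cases n with
  | zero => simpa using ht
  | succ n =>
    rw [Function.iterate_succ_apply']
    exact ⟨betaT_nonneg _ _, betaT_lt_one _ _⟩

theorem iterate_betaT_zero (β : ℝ) (n : ℕ) : (betaT β)^[n] 0 = 0 :=
  Function.iterate_fixed (betaT_zero β) n

theorem iterate_betaT_eq_zero_of_le {β t : ℝ} {m n : ℕ} (hmn : m ≤ n)
    (h : (betaT β)^[m] t = 0) : (betaT β)^[n] t = 0 := by
  obtain ⟨k, rfl⟩ := Nat.exists_eq_add_of_le' hmn
  rw [Function.iterate_add_apply, h, iterate_betaT_zero]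

theorem Admissible.digitVal_mem {β : ℝ} (hβ : 1 < β) :
    ∀ {ds : List ℤ}, Admissible β ds → digitVal β ds ∈ Set.Ico (0 : ℝ) 1
  | [], _ => by simp [digitVal]
  | d :: ds, ⟨hd, hlt, h⟩ => by
    have ih := h.digitVal_mem hβ
    have hd' : (0 : ℝ) ≤ d := by exact_mod_cast hd
    have hpos : 0 < β := by linarith
    refine ⟨div_nonneg (add_nonneg hd' ih.1) hpos.le, ?_⟩
    rw [digitVal, div_lt_one hpos]
    exact hlt

theorem Admissible.iterate_betaT {β : ℝ} (hβ : 1 < β) :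
    ∀ {ds : List ℤ}, Admissible β ds → ∀ k : ℕ,
      (betaT β)^[k] (digitVal β ds) = digitVal β (ds.drop k)
  | _, _, 0 => by simp
  | [], _, k + 1 => by simp [digitVal, iterate_betaT_zero]
  | d :: ds, ⟨_, _, h⟩, k + 1 => by
    have ht := h.digitVal_mem hβ
    rw [Function.iterate_succ_apply, digitVal, betaT_digit hβ d ht.1 ht.2,
      h.iterate_betaT hβ k, List.drop_succ_cons]

theorem Admissible.cons_of_lt {β : ℝ} (hβ : 1 < β) {d : ℤ} {ds : List ℤ}
    (h : Admissible β ds) (hd : 0 ≤ d) (hlt : (d : ℝ) + 1 ≤ β) : Admissible β (d :: ds) :=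
  ⟨hd, by linarith [(h.digitVal_mem hβ).2], h⟩

/-- Once `z < β ^ M`, larger scaling exponents give the same remainder. -/
theorem iterate_betaT_div_pow_add {β z : ℝ} (hβ : 1 < β) (hz : 0 ≤ z) {M : ℕ}
    (hM : z < β ^ M) (k : ℕ) :
    (betaT β)^[M + k] (z / β ^ (M + k)) = (betaT β)^[M] (z / β ^ M) := by
  induction k with
  | zero => rfl
  | succ k ih =>
    have hpos : 0 < β := by linarith
    have hle : β ^ M ≤ β ^ (M + k) := pow_le_pow_right₀ hβ.le (Nat.le_add_right _ _)
    have hstep : betaT β (z / β ^ (M + (k + 1))) = z / β ^ (M + k) := by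
      have h := betaT_digit (t := z / β ^ (M + k)) hβ 0 (by positivity)
        ((div_lt_one (by positivity)).2 (hM.trans_le hle))
      rw [← h]
      congr 1
      rw [← add_assoc, pow_succ]
      simp [div_div]
    rw [← add_assoc, Function.iterate_succ_apply, add_assoc, hstep, ih]

theorem iterate_betaT_eq_zero_of_mem_betaInt {β z : ℝ} (hβ : 1 < β) (hz : 0 ≤ z)
    (h : z ∈ betaInt β) {M : ℕ} (hM : z < β ^ M) : (betaT β)^[M] (z / β ^ M) = 0 := by
  obtain ⟨N, hN, h0⟩ := h
  rw [abs_of_nonneg hz] at hN h0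
  have hN' : z < β ^ N := (div_lt_one (by positivity)).1 hN.2
  rcases le_total M N with hle | hle
  · obtain ⟨k, rfl⟩ := Nat.exists_eq_add_of_le hle
    rwa [iterate_betaT_div_pow_add hβ hz hM] at h0
  · obtain ⟨k, rfl⟩ := Nat.exists_eq_add_of_le hle
    rwa [iterate_betaT_div_pow_add hβ hz hN']

theorem mem_betaInt_of_admissible {β z : ℝ} (hβ : 1 < β) {ds : List ℤ}
    (h : Admissible β ds) (hz : z = β ^ ds.length * digitVal β ds) : z ∈ betaInt β := by
  have hm := h.digitVal_mem hβ
  have hpos : 0 < β := by linarith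
  have hz' : |z| / β ^ ds.length = digitVal β ds := by
    rw [hz, abs_of_nonneg (mul_nonneg (by positivity) hm.1)]
    field_simp
  exact ⟨ds.length, by rwa [hz'], by rw [hz', h.iterate_betaT hβ]; simp [digitVal]⟩

theorem mem_finBeta_of_admissible {β z : ℝ} (hβ : 1 < β) {ds : List ℤ} {N : ℕ}
    (h : Admissible β ds) (hz : z = β ^ N * digitVal β ds) : z ∈ finBeta β := by
  have hm := h.digitVal_mem hβ
  have hpos : 0 < β := by linarith
  have hz' : |z| / β ^ N = digitVal β ds := by
    rw [hz, abs_of_nonneg (mul_nonneg (by positivity) hm.1)]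
    field_simp
  exact ⟨N, ds.length, by rwa [hz'], by rw [hz', h.iterate_betaT hβ]; simp [digitVal]⟩

theorem not_mem_betaInt_of_admissible {β z : ℝ} (hβ : 1 < β) {ds : List ℤ} {N L : ℕ}
    (h : Admissible β ds) (hz : z = β ^ N * digitVal β ds)
    (hne : digitVal β (ds.drop (N + L)) ≠ 0) : β ^ L * z ∉ betaInt β := by
  intro hmem
  have hm := h.digitVal_mem hβ
  have hpos : 0 < β := by linarith
  have hz' : β ^ L * z = β ^ (N + L) * digitVal β ds := by rw [hz]; ring
  rw [hz'] at hmem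
  have h0 := iterate_betaT_eq_zero_of_mem_betaInt hβ (mul_nonneg (by positivity) hm.1) hmem
    (M := N + L) (mul_lt_of_lt_one_right (by positivity) hm.2)
  rw [mul_div_cancel_left₀ _ (by positivity), h.iterate_betaT hβ] at h0
  exact hne h0

/-- The exponents `L` with `β^L·(x·y) ∈ ℤ_β` for all `x, y ∈ ℤ_β` with `x·y ∈ fin(β)`. -/
def mulExponents (β : ℝ) : Set ℕ :=
  {L : ℕ | ∀ x ∈ betaInt β, ∀ y ∈ betaInt β, x * y ∈ finBeta β → β ^ L * (x * y) ∈ betaInt β}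

theorem Lmul_bounds {β : ℝ} {k M : ℕ} (hM : M ∈ mulExponents β)
    (hk : ∀ L < k, L ∉ mulExponents β) : k ≤ Lmul β ∧ Lmul β ≤ M := by
  refine ⟨?_, Nat.sInf_le hM⟩
  by_contra! hlt
  exact hk _ hlt (Nat.sInf_mem ⟨M, hM⟩)

/-- The integer part of `β ^ N * t` is a polynomial in `β` with digits in `[0, a]`; its value at a
conjugate `γ ∈ (0, 1)` is at most `a / (1 - γ)`. -/
theorem exists_polynomial_iterate_betaT {β γ : ℝ} {a : ℤ} (hβ : 1 < β) (ha : β < a + 1)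
    (hγ0 : 0 < γ) (hγ1 : γ < 1) {t : ℝ} (ht : t ∈ Set.Ico (0 : ℝ) 1) (n : ℕ) :
    ∃ p : ℤ[X], β ^ n * t = aeval β p + (betaT β)^[n] t ∧ 0 ≤ aeval γ p ∧
      aeval γ p ≤ a / (1 - γ) := by
  have ha0 : (0 : ℝ) ≤ a := by
    have : (0 : ℝ) < a := by linarith
    exact this.le
  have hsub : 0 < 1 - γ := by linarith
  induction n with
  | zero => exact ⟨0, by simp, by simp, by simpa using div_nonneg ha0 hsub.le⟩
  | succ n ih =>
    obtain ⟨p, hp, hp0, hp1⟩ := ih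
    have hu := iterate_betaT_mem (β := β) ht n
    rw [Function.iterate_succ_apply']
    generalize (betaT β)^[n] t = u at hp hu ⊢
    have hd0 : 0 ≤ ⌊β * u⌋ := Int.floor_nonneg.2 (mul_nonneg (by linarith) hu.1)
    have hd1 : ⌊β * u⌋ ≤ a := by
      refine Int.lt_add_one_iff.1 (Int.floor_lt.2 ?_)
      push_cast
      nlinarith [hu.1, hu.2]
    have hd0' : (0 : ℝ) ≤ ⌊β * u⌋ := by exact_mod_cast hd0
    have hd1' : (⌊β * u⌋ : ℝ) ≤ a := by exact_mod_cast hd1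
    refine ⟨X * p + C ⌊β * u⌋, ?_, ?_, ?_⟩
    · simp only [map_add, map_mul, aeval_X, betaT, eq_intCast, map_intCast]
      linear_combination β * hp
    · simp only [map_add, map_mul, aeval_X, eq_intCast, map_intCast]
      positivity
    · simp only [map_add, map_mul, aeval_X, eq_intCast, map_intCast]
      calc γ * aeval γ p + ⌊β * u⌋ ≤ γ * (a / (1 - γ)) + a := by gcongr
        _ = a / (1 - γ) := by field_simp; ring

theorem exists_polynomial_of_mem_betaInt {β γ : ℝ} {a : ℤ} (hβ : 1 < β) (ha : β < a + 1)
    (hγ0 : 0 < γ) (hγ1 : γ < 1) {x : ℝ} (hx : x ∈ betaInt β) :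
    ∃ p : ℤ[X], |x| = aeval β p ∧ 0 ≤ aeval γ p ∧ aeval γ p ≤ a / (1 - γ) := by
  obtain ⟨N, hN, h0⟩ := hx
  obtain ⟨p, hp, hp'⟩ := exists_polynomial_iterate_betaT hβ ha hγ0 hγ1 hN N
  refine ⟨p, ?_, hp'⟩
  rwa [h0, add_zero, mul_div_cancel₀ _ (by positivity)] at hp

/-- If `t` has exactly `n + 1` digits, the last one is positive, so the value at a conjugate
`γ ∈ (0, 1)` is at least one. -/
theorem exists_polynomial_one_le {β γ : ℝ} {a : ℤ} (hβ : 1 < β) (ha : β < a + 1)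
    (hγ0 : 0 < γ) (hγ1 : γ < 1) {t : ℝ} (ht : t ∈ Set.Ico (0 : ℝ) 1) {n : ℕ}
    (hn : (betaT β)^[n] t ≠ 0) (hn1 : (betaT β)^[n + 1] t = 0) :
    ∃ p : ℤ[X], β ^ (n + 1) * t = aeval β p ∧ 1 ≤ aeval γ p := by
  obtain ⟨p, hp, hp0, -⟩ := exists_polynomial_iterate_betaT hβ ha hγ0 hγ1 ht n
  have hu := iterate_betaT_mem (β := β) ht n
  rw [Function.iterate_succ_apply'] at hn1
  generalize (betaT β)^[n] t = u at hp hu hn hn1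
  have hupos : 0 < u := lt_of_le_of_ne hu.1 (Ne.symm hn)
  have hfl : β * u = ⌊β * u⌋ := sub_eq_zero.1 hn1
  have hd : (0 : ℝ) < ⌊β * u⌋ := by rw [← hfl]; positivity
  have hd1 : (1 : ℝ) ≤ ⌊β * u⌋ := by exact_mod_cast (Int.cast_pos.1 hd)
  refine ⟨X * p + C ⌊β * u⌋, ?_, ?_⟩
  · simp only [map_add, map_mul, aeval_X, eq_intCast, map_intCast]
    linear_combination β * hp + hfl
  · simp only [map_add, map_mul, aeval_X, eq_intCast, map_intCast]
    have : 0 ≤ γ * aeval γ p := by positivity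
    linarith

theorem mem_mulExponents {β γ : ℝ} {a : ℤ} (hβ : 1 < β) (ha : β < a + 1)
    (hγ0 : 0 < γ) (hγ1 : γ < 1)
    (hconj : ∀ p : ℤ[X], aeval β p = 0 → aeval γ p = 0) {M : ℕ}
    (hM : γ ^ (M + 1) * (a : ℝ) ^ 2 < (1 - γ) ^ 2) : M ∈ mulExponents β := by
  classical
  intro x hx y hy hxy
  have hpos : 0 < β := by linarith
  obtain ⟨p, hpx, hp0, hp1⟩ := exists_polynomial_of_mem_betaInt hβ ha hγ0 hγ1 hx
  obtain ⟨q, hqy, hq0, hq1⟩ := exists_polynomial_of_mem_betaInt hβ ha hγ0 hγ1 hy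
  obtain ⟨N, n, ht, h0⟩ := hxy
  set t := |x * y| / β ^ N with ht_def
  have hex : ∃ n, (betaT β)^[n] t = 0 := ⟨n, h0⟩
  have hscale : |β ^ M * (x * y)| / β ^ (N + M) = t := by
    rw [abs_mul, abs_of_pos (pow_pos hpos M), ht_def, pow_add]
    field_simp
  suffices hle : (betaT β)^[N + M] t = 0 from
    ⟨N + M, by rwa [hscale], by rwa [hscale]⟩
  refine iterate_betaT_eq_zero_of_le ?_ (Nat.find_spec hex)
  by_contra! hlt
  obtain ⟨k, hk⟩ : ∃ k, Nat.find hex = N + M + k + 1 := by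
    obtain ⟨k, hk⟩ := Nat.exists_eq_add_of_lt hlt
    exact ⟨k, hk⟩
  have hn1 := Nat.find_spec hex
  rw [hk] at hn1
  have hn : (betaT β)^[N + M + k] t ≠ 0 := Nat.find_min hex (by omega)
  obtain ⟨r, hr, hr1⟩ := exists_polynomial_one_le hβ ha hγ0 hγ1 ht hn hn1
  have hr' : aeval β (r - X ^ (M + k + 1) * (p * q)) = 0 := by
    simp only [map_sub, map_mul, map_pow, aeval_X]
    rw [← hr, ← hpx, ← hqy, ← abs_mul, ht_def,
      show N + M + k + 1 = N + (M + k + 1) by ring, pow_add]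
    field_simp
    ring
  have hc := hconj _ hr'
  simp only [map_sub, map_mul, map_pow, aeval_X, sub_eq_zero] at hc
  have hsub : 0 < 1 - γ := by linarith
  have : (1 : ℝ) < 1 := calc
    1 ≤ γ ^ (M + k + 1) * (aeval γ p * aeval γ q) := hc ▸ hr1
    _ ≤ γ ^ (M + 1) * ((a / (1 - γ)) * (a / (1 - γ))) := by
      refine mul_le_mul ?_ ?_ (by positivity) (by positivity)
      · exact pow_le_pow_of_le_one hγ0.le hγ1.le (by omega)
      · exact mul_le_mul hp1 hq1 hq0 (hp0.trans hp1)
    _ = γ ^ (M + 1) * (a : ℝ) ^ 2 / (1 - γ) ^ 2 := by field_simp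
    _ < 1 := (div_lt_one (by positivity)).2 hM
  exact lt_irrefl _ this

theorem irreducible_cubic {a b : ℤ} (hb : 0 < b) (hba : b < a) :
    Irreducible (X ^ 3 - C (a : ℚ) * X ^ 2 - C (b : ℚ) * X + 1 : ℚ[X]) := by
  have hdeg : (X ^ 3 - C (a : ℚ) * X ^ 2 - C (b : ℚ) * X + 1 : ℚ[X]).natDegree = 3 := by
    compute_degree!
  rw [irreducible_iff_roots_eq_zero_of_degree_le_three (by omega) (by omega),
    Multiset.eq_zero_iff_forall_notMem]
  intro r hr
  have hr0 : r ^ 3 - a * r ^ 2 - b * r + 1 = 0 := by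
    simpa [IsRoot] using isRoot_of_mem_roots hr
  have hmon : (X ^ 3 - C a * X ^ 2 - C b * X + 1 : ℤ[X]).Monic := by monicity!
  obtain ⟨m, hm⟩ := isInteger_of_is_root_of_monic hmon (r := r) (by simpa using hr0)
  have hm' : r = m := by simpa using hm.symm
  subst hm'
  have hm0 : m ^ 3 - a * m ^ 2 - b * m + 1 = 0 := by exact_mod_cast hr0
  have hunit : IsUnit m := IsUnit.of_mul_eq_one (a * m + b - m ^ 2) (by linear_combination -hm0)
  rcases Int.isUnit_iff.1 hunit with rfl | rfl <;> omega

theorem aeval_conjugate_eq_zero {a b : ℤ} (hb : 0 < b) (hba : b < a) {β γ : ℝ}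
    (hβ : β ^ 3 - (a : ℝ) * β ^ 2 - (b : ℝ) * β + 1 = 0)
    (hγ : γ ^ 3 - (a : ℝ) * γ ^ 2 - (b : ℝ) * γ + 1 = 0) (p : ℤ[X]) (hp : aeval β p = 0) :
    aeval γ p = 0 := by
  have hirr := irreducible_cubic hb hba
  have hmon : (X ^ 3 - C (a : ℚ) * X ^ 2 - C (b : ℚ) * X + 1 : ℚ[X]).Monic := by monicity!
  have hmin := minpoly.eq_of_irreducible_of_monic hirr (x := β) (by simpa using hβ) hmon
  have hdvd := minpoly.dvd ℚ β (p := p.map (Int.castRingHom ℚ))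
    (by rw [← algebraMap_int_eq, aeval_map_algebraMap]; exact hp)
  rw [← hmin] at hdvd
  have := aeval_eq_zero_of_dvd_aeval_eq_zero (x := γ) hdvd (by simpa using hγ)
  rwa [← algebraMap_int_eq, aeval_map_algebraMap] at this

theorem exists_conjugate_lt {a b : ℤ} {c : ℝ} (hc : 0 < c)
    (hneg : c ^ 3 - (a : ℝ) * c ^ 2 - (b : ℝ) * c + 1 < 0) :
    ∃ γ : ℝ, 0 < γ ∧ γ < c ∧ γ ^ 3 - (a : ℝ) * γ ^ 2 - (b : ℝ) * γ + 1 = 0 := by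
  have hcont : ContinuousOn (fun t : ℝ => t ^ 3 - (a : ℝ) * t ^ 2 - (b : ℝ) * t + 1)
      (Set.Icc 0 c) := by fun_prop
  obtain ⟨γ, hγ, h0⟩ := intermediate_value_Ioo' hc.le hcont
    (show (0 : ℝ) ∈ Set.Ioo _ _ from ⟨hneg, by norm_num⟩)
  exact ⟨γ, hγ.1, hγ.2, h0⟩

theorem lt_cubic_root {a b : ℤ} (hb : 0 < b) {β : ℝ} (hβ : 1 < β)
    (hroot : β ^ 3 - (a : ℝ) * β ^ 2 - (b : ℝ) * β + 1 = 0) : (a : ℝ) < β := by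
  have hb' : (1 : ℝ) ≤ b := by exact_mod_cast hb
  have h : 0 < β ^ 2 * (β - a) := by nlinarith
  linarith [pos_of_mul_pos_right h (by positivity)]

theorem cubic_root_lt {a b : ℤ} (hb : 0 < b) (hba : b < a) {β : ℝ} (hβ : 1 < β)
    (hroot : β ^ 3 - (a : ℝ) * β ^ 2 - (b : ℝ) * β + 1 = 0) : β < a + 1 := by
  have hlt := lt_cubic_root hb hβ hroot
  have hb' : (b : ℝ) < a := by exact_mod_cast hba
  by_contra! hge
  nlinarith [mul_pos (show 0 < β by linarith) (show 0 < β - b by linarith),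
    mul_nonneg (sq_nonneg β) (show 0 ≤ β - (a + 1) by linarith)]

theorem four_mem_mulExponents {a b : ℤ} (hb : 0 < b) (hba : b < a) (ha : 3 ≤ a) {β : ℝ}
    (hβ : 1 < β) (hroot : β ^ 3 - (a : ℝ) * β ^ 2 - (b : ℝ) * β + 1 = 0) :
    4 ∈ mulExponents β := by
  have ha' : (3 : ℝ) ≤ a := by exact_mod_cast ha
  have hb' : (1 : ℝ) ≤ b := by exact_mod_cast hb
  obtain ⟨γ, h0, h1, hγ⟩ := exists_conjugate_lt (a := a) (b := b) (c := 47 / 100)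
    (by norm_num) (by linarith)
  refine mem_mulExponents hβ (cubic_root_lt hb hba hβ hroot) h0 (by linarith)
    (aeval_conjugate_eq_zero hb hba hroot hγ) ?_
  have hle : a * γ ^ 2 ≤ 1 - γ + γ ^ 3 := by nlinarith
  have hcube : γ ^ 3 ≤ (47 / 100) ^ 3 := by gcongr
  have hle' : a * γ ^ 2 ≤ 6 / 5 * (1 - γ) := by linarith
  calc γ ^ (4 + 1) * (a : ℝ) ^ 2 = (a * γ ^ 2) ^ 2 * γ := by ring
    _ ≤ (6 / 5 * (1 - γ)) ^ 2 * γ := by gcongr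
    _ ≤ (6 / 5 * (1 - γ)) ^ 2 * (47 / 100) := by gcongr
    _ < (1 - γ) ^ 2 := by nlinarith [pow_pos (show 0 < 1 - γ by linarith) 2]

theorem five_mem_mulExponents {β : ℝ} (hβ : 1 < β)
    (hroot : β ^ 3 - ((2 : ℤ) : ℝ) * β ^ 2 - ((1 : ℤ) : ℝ) * β + 1 = 0) :
    5 ∈ mulExponents β := by
  obtain ⟨γ, h0, h1, hγ⟩ := exists_conjugate_lt (a := 2) (b := 1) (c := 56 / 100)
    (by norm_num) (by norm_num)
  refine mem_mulExponents hβ (cubic_root_lt (b := 1) (by norm_num) (by norm_num) hβ hroot) h0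
    (by linarith) (aeval_conjugate_eq_zero (b := 1) (by norm_num) (by norm_num) hroot hγ) ?_
  calc γ ^ (5 + 1) * ((2 : ℤ) : ℝ) ^ 2 ≤ (56 / 100) ^ (5 + 1) * ((2 : ℤ) : ℝ) ^ 2 := by gcongr
    _ < (1 - 56 / 100) ^ 2 := by norm_num
    _ ≤ (1 - γ) ^ 2 := by gcongr

/-- With `x = b d.` and `y = a.` the product `x·y = b 1 r . 0 1` has two fractional digits. -/
theorem not_mem_mulExponents_of_lt_two {a b : ℤ} (hb : 0 < b) (hba : b < a) {β : ℝ}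
    (hβ : 1 < β) (hroot : β ^ 3 - (a : ℝ) * β ^ 2 - (b : ℝ) * β + 1 = 0) :
    ∀ L < 2, L ∉ mulExponents β := by
  have hlt := lt_cubic_root hb hβ hroot
  have hpos : 0 < β := by linarith
  have ha : 0 < a := by omega
  have digit_le {d : ℤ} (hd : d < a) : (d : ℝ) + 1 ≤ β := by
    have : ((d + 1 : ℤ) : ℝ) ≤ a := by exact_mod_cast hd
    push_cast at this
    linarith
  obtain ⟨d, r, hd0, hda, hr0, hra, hdr⟩ : ∃ d r : ℤ, 0 ≤ d ∧ d ≤ a ∧ 0 ≤ r ∧ r < a ∧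
      d * a = a + b ^ 2 + r := by
    have hq := Int.mul_ediv_add_emod (-b ^ 2) a
    have hr0 := Int.emod_nonneg (-b ^ 2) ha.ne'
    have hra := Int.emod_lt_of_pos (-b ^ 2) ha
    generalize -b ^ 2 / a = q at hq
    generalize -b ^ 2 % a = r at hq hr0 hra
    refine ⟨1 - q, r, ?_, ?_, hr0, hra, by linear_combination -hq⟩
    · by_contra! h
      nlinarith [sq_nonneg b]
    · by_contra! h
      nlinarith
  have hdr' : (d : ℝ) * a = a + b ^ 2 + r := by exact_mod_cast hdr
  have hda' : (d : ℝ) ≤ a := by exact_mod_cast hda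
  have hnil : Admissible β [] := trivial
  have hx : Admissible β [b, d] :=
    Admissible.cons_of_lt hβ ⟨hd0, by simp only [digitVal]; linarith, hnil⟩ hb.le (digit_le hba)
  have hy : Admissible β [a] := ⟨ha.le, by simp only [digitVal]; linarith, hnil⟩
  have hxy : Admissible β [b, 1, r, 0, 1] :=
    ((((hnil.cons_of_lt hβ zero_le_one (digit_le (by omega))).cons_of_lt hβ le_rfl
      (digit_le ha)).cons_of_lt hβ hr0 (digit_le hra)).cons_of_lt hβ zero_le_one
      (digit_le (by omega))).cons_of_lt hβ hb.le (digit_le hba)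
  have hprod : (b * β + d) * a = β ^ 3 * digitVal β [b, 1, r, 0, 1] := by
    simp only [digitVal]
    field_simp
    push_cast
    linear_combination (-(b * β) - 1) * hroot + β ^ 2 * hdr'
  intro L hL hmem
  refine not_mem_betaInt_of_admissible (L := L) hβ hxy hprod ?_ (hmem _ ?_ _ ?_
    (mem_finBeta_of_admissible hβ hxy hprod))
  · interval_cases L <;> simp [digitVal, hpos.ne']
  · refine mem_betaInt_of_admissible hβ hx ?_
    simp only [digitVal, List.length]
    field_simp
    ring
  · refine mem_betaInt_of_admissible hβ hy ?_
    simp only [digitVal, List.length]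
    field_simp
    ring

/-- For `(a, b) = (2, 1)` the square of `x = 1012.` is `1120101.001`. -/
theorem not_mem_mulExponents_of_lt_three {β : ℝ} (hβ : 1 < β)
    (hroot : β ^ 3 - ((2 : ℤ) : ℝ) * β ^ 2 - ((1 : ℤ) : ℝ) * β + 1 = 0) :
    ∀ L < 3, L ∉ mulExponents β := by
  have hlt := lt_cubic_root zero_lt_one hβ hroot
  have hpos : 0 < β := by linarith
  push_cast at hroot hlt
  have hnil : Admissible β [] := trivial
  have h0 {ds : List ℤ} (h : Admissible β ds) : Admissible β (0 :: ds) :=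
    h.cons_of_lt hβ le_rfl (by push_cast; linarith)
  have h1 {ds : List ℤ} (h : Admissible β ds) : Admissible β (1 :: ds) :=
    h.cons_of_lt hβ zero_le_one (by push_cast; linarith)
  have hx : Admissible β [1, 0, 1, 2] :=
    h1 (h0 (h1 ⟨zero_le_two, by simp only [digitVal]; push_cast; linarith, hnil⟩))
  have htail : Admissible β [0, 1, 0, 1, 0, 0, 1] := h0 (h1 (h0 (h1 (h0 (h0 (h1 hnil))))))
  have htwo : ((2 : ℤ) : ℝ) + digitVal β [0, 1, 0, 1, 0, 0, 1] < β := by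
    have hval : digitVal β [0, 1, 0, 1, 0, 0, 1] = (β ^ 5 + β ^ 3 + 1) / β ^ 7 := by
      simp only [digitVal]
      field_simp
      push_cast
      ring
    rw [hval, ← lt_sub_iff_add_lt', div_lt_iff₀ (by positivity)]
    push_cast
    have hkey : 0 < β ^ 2 - β - 1 := by nlinarith
    linear_combination hkey - (β ^ 5 + β ^ 3 + β) * hroot
  have hxx : Admissible β [1, 1, 2, 0, 1, 0, 1, 0, 0, 1] :=
    h1 (h1 ⟨zero_le_two, htwo, htail⟩)
  have hprod : (β ^ 3 + β + 2) * (β ^ 3 + β + 2) =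
      β ^ 7 * digitVal β [1, 1, 2, 0, 1, 0, 1, 0, 0, 1] := by
    simp only [digitVal]
    field_simp
    push_cast
    linear_combination (-(β ^ 5 + 2 * β ^ 4 + β ^ 3 + 3 * β ^ 2 + β + 1)) * hroot
  have hmemx : β ^ 3 + β + 2 ∈ betaInt β := by
    refine mem_betaInt_of_admissible hβ hx ?_
    simp only [digitVal, List.length]
    field_simp
    push_cast
    ring
  intro L hL hmem
  refine not_mem_betaInt_of_admissible (L := L) hβ hxx hprod ?_ (hmem _ hmemx _ hmemx
    (mem_finBeta_of_admissible hβ hxx hprod))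
  interval_cases L <;> simp [digitVal, hpos.ne']

theorem stmt14 (a b : ℤ) (hb : 0 < b) (hba : b < a) (β : ℝ) (hβ : 1 < β)
    (hroot : β ^ 3 - (a : ℝ) * β ^ 2 - (b : ℝ) * β + 1 = 0) :
    (¬ (a = 2 ∧ b = 1) → 2 ≤ Lmul β ∧ Lmul β ≤ 4) ∧
    ((a = 2 ∧ b = 1) → 3 ≤ Lmul β ∧ Lmul β ≤ 5) := by
  refine ⟨fun h => Lmul_bounds (four_mem_mulExponents hb hba (by omega) hβ hroot)
    (not_mem_mulExponents_of_lt_two hb hba hβ hroot), ?_⟩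
  rintro ⟨rfl, rfl⟩
  exact Lmul_bounds (five_mem_mulExponents hβ hroot) (not_mem_mulExponents_of_lt_three hβ hroot)
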